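/- Let A be a skew shape and let α be a composition in Fsupp(A), i.e., α is the descent composition of some standard Young tableau of shape A. Then the partition obtained by sorting the parts of α into weakly decreasing order is dominated by cols(A)^t: sort(α) ⊴ cols(A)^t. -/

import Mathlib

namespace SkewPaper

open Finset

/-- A skew shape `λ/μ`, given by Young diagrams `μ ≤ λ`. -/
structure SkewShape where
  lam : YoungDiagram
  mu : YoungDiagram
  sub : mu ≤ lam

namespace SkewShape

/-- The cells (boxes) of the skew shape `λ/μ`. -/
def cells (A : SkewShape) : Finset (ℕ × ℕ) :=
  A.lam.cells \ A.mu.cells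

/-- The number of boxes of `A`. -/
def size (A : SkewShape) : ℕ := A.cells.card

end SkewShape

/-- The set of columns occupied by row `i` of the cell set `s`. -/
def rowCols (s : Finset (ℕ × ℕ)) (i : ℕ) : Finset ℕ :=
  (s.filter (fun c => c.1 = i)).image Prod.snd

/-- The set of rows occupied by column `j` of the cell set `s`. -/
def colRows (s : Finset (ℕ × ℕ)) (j : ℕ) : Finset ℕ :=
  (s.filter (fun c => c.2 = j)).image Prod.fst

/-- `overlapRow s k i` : the number of columns occupied in common by
rows `i, i+1, …, i+k-1` of `s`. -/
def overlapRow (s : Finset (ℕ × ℕ)) (k i : ℕ) : ℕ :=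
  ((rowCols s i).filter (fun j => ∀ t, t < k → j ∈ rowCols s (i + t))).card

/-- `overlapCol s l j` : the number of rows occupied in common by
columns `j, j+1, …, j+l-1` of `s`. -/
def overlapCol (s : Finset (ℕ × ℕ)) (l j : ℕ) : ℕ :=
  ((colRows s j).filter (fun i => ∀ t, t < l → i ∈ colRows s (j + t))).card

/-- `rows_k`: the partition (as the multiset of its nonzero parts) of overlaps of
`k` consecutive rows. -/
def rowsk (s : Finset (ℕ × ℕ)) (k : ℕ) : Multiset ℕ :=
  ((s.image Prod.fst).val.map (overlapRow s k)).filter (fun m => 0 < m)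

/-- `cols_l`: the partition (as the multiset of its nonzero parts) of overlaps of
`l` consecutive columns. -/
def colsk (s : Finset (ℕ × ℕ)) (l : ℕ) : Multiset ℕ :=
  ((s.image Prod.snd).val.map (overlapCol s l)).filter (fun m => 0 < m)

/-- `rects s k l`: the number of `k × l` rectangles of boxes contained inside `s`. -/
def rects (s : Finset (ℕ × ℕ)) (k l : ℕ) : ℕ :=
  (s.filter (fun c => ∀ a, a < k → ∀ b, b < l → (c.1 + a, c.2 + b) ∈ s)).card

/-- The weakly decreasing sorted list of a multiset: the partition with those parts. -/
def sortDesc (s : Multiset ℕ) : List ℕ := (s.sort (· ≤ ·)).reverse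

/-- Dominance order on partitions presented as multisets of parts:
every partial sum of the decreasing sort of `s` is at most the corresponding
partial sum for `t` (missing parts treated as `0`). -/
def Dom (s t : Multiset ℕ) : Prop :=
  ∀ j : ℕ, ((sortDesc s).take j).sum ≤ ((sortDesc t).take j).sum

/-- The conjugate (transpose) of a partition presented as a multiset of parts. -/
def conjM (s : Multiset ℕ) : Multiset ℕ :=
  (Multiset.range s.sup).map (fun j => Multiset.card (s.filter (fun x => j < x)))

/-- A standard Young tableau of shape `A`: a bijective filling of the cells of `A`
by `1, …, |A|` which increases from left to right along rows and from top to
bottom down columns.  (Entries off the shape are normalized to `0`.) -/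
structure SYT (A : SkewShape) where
  entry : ℕ × ℕ → ℕ
  zero_off : ∀ c, c ∉ A.cells → entry c = 0
  mem_range : ∀ c ∈ A.cells, entry c ∈ Finset.Icc 1 A.size
  injOn : Set.InjOn entry ↑A.cells
  row_lt : ∀ i j j', (i, j) ∈ A.cells → (i, j') ∈ A.cells → j < j' →
    entry (i, j) < entry (i, j')
  col_lt : ∀ i i' j, (i, j) ∈ A.cells → (i', j) ∈ A.cells → i < i' →
    entry (i, j) < entry (i', j)

/-- The descent set of a standard Young tableau: those `k ∈ {1, …, n-1}` such that
`k+1` appears in a strictly lower row than `k`. -/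
def SYT.descentSet {A : SkewShape} (T : SYT A) : Finset ℕ :=
  (Finset.Ico 1 A.size).filter (fun k =>
    ∃ c ∈ A.cells, ∃ c' ∈ A.cells, T.entry c = k ∧ T.entry c' = k + 1 ∧ c.1 < c'.1)

/-- The composition of `n` corresponding to a subset `D ⊆ {1, …, n-1}`:
its partial sums are the elements of `D`. -/
def compOfSet (n : ℕ) (D : Finset ℕ) : List ℕ :=
  if n = 0 then []
  else
    let l := D.sort (· ≤ ·) ++ [n]
    List.zipWith (fun x y => x - y) l (0 :: l)

/-- The descent composition of a standard Young tableau. -/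
def SYT.descentComp {A : SkewShape} (T : SYT A) : List ℕ :=
  compOfSet A.size T.descentSet

/-- The F-support of `A`: the set of descent compositions of SYT of shape `A`. -/
def Fsupp (A : SkewShape) : Set (List ℕ) :=
  {α | ∃ T : SYT A, T.descentComp = α}

/-- The number of standard Young tableaux of shape `A` with descent composition `α`. -/
noncomputable def countSYT (A : SkewShape) (α : List ℕ) : ℕ :=
  Nat.card {T : SYT A // T.descentComp = α}

/-- `S(γ)`: the set of proper partial sums of the composition `γ`. -/
def Sset (γ : List ℕ) : Finset ℕ :=
  ((List.range (γ.length - 1)).map (fun j => (γ.take (j + 1)).sum)).toFinset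

/-- `cols(α)` for a composition `α` of `n`, as a multiset: the parts of the
composition corresponding to the complement of `S(α)` in `{1, …, n-1}`. -/
def colsComp (α : List ℕ) : Multiset ℕ :=
  ↑(compOfSet α.sum ((Finset.Icc 1 (α.sum - 1)) \ Sset α))

/-- Delete the leftmost box of every nonempty row. -/
def trimCells (s : Finset (ℕ × ℕ)) : Finset (ℕ × ℕ) :=
  s.filter (fun c => 1 ≤ c.2 ∧ (c.1, c.2 - 1) ∈ s)

/-- `s` is a ribbon whose (nonempty) rows are exactly rows `r0, …, r1`, with every
pair of adjacent rows overlapping in exactly one column. -/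
def IsRibbonOn (s : Finset (ℕ × ℕ)) (r0 r1 : ℕ) : Prop :=
  r0 ≤ r1 ∧ (∀ i, (rowCols s i).Nonempty ↔ r0 ≤ i ∧ i ≤ r1) ∧
    (∀ i, r0 ≤ i → i < r1 → (rowCols s i ∩ rowCols s (i + 1)).card = 1)

/-- `A` is a ribbon. -/
def SkewShape.IsRibbon (A : SkewShape) : Prop :=
  ∃ r0 r1, IsRibbonOn A.cells r0 r1

/-- An elongated ribbon: a ribbon all of whose rows have length at least two. -/
def ElongatedRibbon (A : SkewShape) : Prop :=
  A.IsRibbon ∧ ∀ i, (rowCols A.cells i).Nonempty → 2 ≤ (rowCols A.cells i).card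

/-- A horizontal strip: at most one box in each column. -/
def IsHorizontalStrip (A : SkewShape) : Prop :=
  ∀ j, (colRows A.cells j).card ≤ 1

/-- `A` is F-multiplicity-free: distinct SYT of shape `A` have distinct descent sets. -/
def FMultFree (A : SkewShape) : Prop :=
  ∀ T T' : SYT A, T.descentSet = T'.descentSet → T = T'

/-- The cells of a shape, viewed inside `ℤ × ℤ`. -/
def toZ (s : Finset (ℕ × ℕ)) : Finset (ℤ × ℤ) :=
  s.image (fun c => ((c.1 : ℤ), (c.2 : ℤ)))

/-- The cells of the hook `(m, 1^l)`. -/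
def hookCells (m l : ℕ) : Finset (ℕ × ℕ) :=
  ((Finset.range m).image (fun j => ((0 : ℕ), j))) ∪
    ((Finset.Icc 1 l).image (fun i => (i, (0 : ℕ))))

lemma sum_le_sum_take_of_sublist {L : List ℕ} (hL : L.Pairwise (· ≥ ·)) {l : List ℕ}
    (h : l.Sublist L) {j : ℕ} (hj : l.length ≤ j) : l.sum ≤ (L.take j).sum := by
  induction L generalizing l j with
  | nil => simp_all
  | cons a L ih =>
    cases l with
    | nil => simp
    | cons b l =>
      obtain _ | j := j
      · simp at hj
      have hb : b ≤ a := by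
        rcases List.mem_cons.1 (h.subset (List.mem_cons_self)) with rfl | hb
        · exact le_rfl
        · exact (List.pairwise_cons.1 hL).1 b hb
      have := ih (List.pairwise_cons.1 hL).2 (l := l) h.tail (j := j) (by simpa using hj)
      simp only [List.sum_cons, List.take_succ_cons]
      omega

lemma coe_sortDesc (s : Multiset ℕ) : (↑(sortDesc s) : Multiset ℕ) = s := by
  simp [sortDesc]

lemma pairwise_sortDesc (s : Multiset ℕ) : (sortDesc s).Pairwise (· ≥ ·) := by
  rw [sortDesc, List.pairwise_reverse]
  exact Multiset.pairwise_sort s (· ≤ ·)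

lemma sum_le_sum_take_sortDesc {u t : Multiset ℕ} (h : u ≤ t) {j : ℕ}
    (hj : Multiset.card u ≤ j) : u.sum ≤ ((sortDesc t).take j).sum := by
  induction u using Quotient.inductionOn with
  | h l =>
    rw [← coe_sortDesc t] at h
    obtain ⟨l', hp, hs⟩ := Multiset.coe_le.1 h
    have := sum_le_sum_take_of_sublist (pairwise_sortDesc t) hs (j := j)
      (by rw [hp.length_eq]; simpa using hj)
    rwa [hp.sum_eq] at this

lemma exists_finset_of_le_map {n : ℕ} {f : ℕ → ℕ} {u : Multiset ℕ}
    (h : u ≤ (Multiset.range n).map f) :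
    ∃ I ⊆ Finset.range n, I.val.map f = u := by
  induction u using Quotient.inductionOn with
  | h l =>
    obtain ⟨l', hp, hs⟩ : l.Subperm ((List.range n).map f) := h
    obtain ⟨m, hm, rfl⟩ := List.sublist_map_iff.1 hs
    have hnd : m.Nodup := List.nodup_range.sublist hm
    refine ⟨⟨m, hnd⟩, fun x hx => ?_, ?_⟩
    · simpa using hm.subset hx
    · simpa using hp

lemma sum_card_filter_lt (s : Multiset ℕ) (m : ℕ) :
    ∑ i ∈ Finset.range m, Multiset.card (s.filter (fun x => i < x)) =
      (s.map (fun x => min m x)).sum := by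
  induction s using Multiset.induction with
  | empty => simp
  | cons a s ih =>
    have h : (Finset.range m).filter (fun i => i < a) = Finset.range (min m a) := by
      ext; simp
    simp only [Multiset.filter_cons, Multiset.card_add, Finset.sum_add_distrib, ih,
      Multiset.map_cons, Multiset.sum_cons]
    congr 1
    rw [← Finset.card_range (min m a), ← h, Finset.card_filter]
    exact Finset.sum_congr rfl fun i _ => by split_ifs <;> simp

lemma sum_min_le_sum_take_conjM (s : Multiset ℕ) (j : ℕ) :
    (s.map (fun x => min j x)).sum ≤ ((sortDesc (conjM s)).take j).sum := by
  have h : (Multiset.range (min j s.sup)).map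
      (fun i => Multiset.card (s.filter (fun x => i < x))) ≤ conjM s :=
    Multiset.map_le_map (Multiset.range_le.2 (min_le_right _ _))
  refine le_trans (le_of_eq ?_) (sum_le_sum_take_sortDesc h (j := j) (by simp))
  have := sum_card_filter_lt s (min j s.sup)
  rw [Finset.sum, Finset.range_val] at this
  rw [this]
  congr 1
  refine Multiset.map_congr rfl fun x hx => ?_
  have := Multiset.le_sup hx
  omega

lemma sum_map_colsk_one (s : Finset (ℕ × ℕ)) {f : ℕ → ℕ} (hf : f 0 = 0) :
    ((colsk s 1).map f).sum =
      ∑ c ∈ s.image Prod.snd, f (s.filter (fun x => x.2 = c)).card := by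
  have hcard (c : ℕ) : overlapCol s 1 c = (s.filter (fun x => x.2 = c)).card := by
    rw [overlapCol, Finset.filter_true_of_mem]
    · refine Finset.card_image_of_injOn ?_
      rintro ⟨a, b⟩ h ⟨a', b'⟩ h' hab
      simp_all
    · intro i hi t ht
      obtain rfl : t = 0 := by omega
      exact hi
  have hfil (m : Multiset ℕ) : ((m.filter (fun x => 0 < x)).map f).sum = (m.map f).sum := by
    induction m using Multiset.induction with
    | empty => simp
    | cons a m ih =>
      rcases Nat.eq_zero_or_pos a with rfl | ha
      · simp [ih, hf]
      · simp [ih, ha]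
  rw [colsk, hfil, Multiset.map_map, Finset.sum]
  simp [hcard]

/-- The increasing sequence `0, d₁, …, dᵣ, n` of the endpoints of the blocks cut out by `D`. -/
def breaks (n : ℕ) (D : Finset ℕ) (i : ℕ) : ℕ :=
  (0 :: (D.sort (· ≤ ·) ++ [n])).getD i 0

lemma compOfSet_eq_map_breaks {n : ℕ} (hn : n ≠ 0) (D : Finset ℕ) :
    compOfSet n D =
      (List.range (D.card + 1)).map (fun i => breaks n D (i + 1) - breaks n D i) := by
  rw [compOfSet, if_neg hn]
  apply List.ext_getElem
  · simp
  · intro i h₁ h₂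
    have hi : i < D.card + 1 := by simpa using h₂
    simp only [breaks, List.getElem_zipWith, List.getElem_map, List.getElem_range]
    rw [List.getD_eq_getElem _ _ (by simp; omega), List.getD_eq_getElem _ _ (by simp; omega)]
    rfl

lemma breaks_lt_breaks {n : ℕ} {D : Finset ℕ} (hn : n ≠ 0) (hD : D ⊆ Finset.Ico 1 n) {i j : ℕ}
    (hij : i < j) (hj : j ≤ D.card + 1) : breaks n D i < breaks n D j := by
  have hp : (0 :: (D.sort (· ≤ ·) ++ [n])).Pairwise (· < ·) := by
    have hD' : ∀ d ∈ D, 1 ≤ d ∧ d < n := fun d hd => Finset.mem_Ico.1 (hD hd)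
    rw [List.pairwise_cons, List.pairwise_append]
    refine ⟨fun d hd => ?_, ?_, List.pairwise_singleton _ _, fun d hd m hm => ?_⟩
    · rcases List.mem_append.1 hd with hd | hd
      · exact (hD' d ((Finset.mem_sort _).1 hd)).1
      · rw [List.mem_singleton.1 hd]; omega
    · exact (Finset.sortedLT_sort D).pairwise
    · rw [List.mem_singleton.1 hm]
      exact (hD' d ((Finset.mem_sort _).1 hd)).2
  rw [breaks, breaks, List.getD_eq_getElem _ _ (by simp; omega),
    List.getD_eq_getElem _ _ (by simp; omega)]
  exact List.pairwise_iff_getElem.1 hp _ _ _ _ hij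

lemma exists_breaks_eq {n d : ℕ} {D : Finset ℕ} (hd : d ∈ insert n D) :
    ∃ m ≤ D.card + 1, breaks n D m = d := by
  have : d ∈ D.sort (· ≤ ·) ++ [n] := by
    rw [List.mem_append, Finset.mem_sort, List.mem_singleton, or_comm]
    exact Finset.mem_insert.1 hd
  obtain ⟨m, hm, rfl⟩ := List.getElem_of_mem this
  have hm' : m < D.card + 1 := by simpa using hm
  refine ⟨m + 1, by omega, ?_⟩
  rw [breaks, List.getD_eq_getElem _ _ (by simp; omega), List.getElem_cons_succ]

lemma breaks_le {n : ℕ} {D : Finset ℕ} (hn : n ≠ 0) (hD : D ⊆ Finset.Ico 1 n) {i : ℕ}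
    (hi : i ≤ D.card + 1) : breaks n D i ≤ n := by
  have hlast : breaks n D (D.card + 1) = n := by
    rw [breaks, List.getD_eq_getElem _ _ (by simp), List.getElem_cons_succ]
    simp
  rcases hi.lt_or_eq with h | rfl
  · exact (breaks_lt_breaks hn hD h le_rfl).le.trans hlast.le
  · exact hlast.le

lemma notMem_of_breaks_lt {n : ℕ} {D : Finset ℕ} (hn : n ≠ 0) (hD : D ⊆ Finset.Ico 1 n) {i d : ℕ}
    (hi : i ≤ D.card) (h₁ : breaks n D i < d) (h₂ : d < breaks n D (i + 1)) : d ∉ D := by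
  intro hd
  obtain ⟨m, hm, rfl⟩ := exists_breaks_eq (n := n) (Finset.mem_insert_of_mem hd)
  rcases lt_trichotomy m i with h | rfl | h
  · exact (breaks_lt_breaks hn hD h (by omega)).not_gt h₁
  · exact h₁.false
  · rcases (Nat.succ_le_of_lt h).lt_or_eq with h | rfl
    · exact (breaks_lt_breaks hn hD h hm).not_gt h₂
    · exact h₂.false

namespace SYT

variable {A : SkewShape} (T : SYT A)

lemma descentSet_subset : T.descentSet ⊆ Finset.Ico 1 A.size := Finset.filter_subset _ _

lemma image_entry : A.cells.image T.entry = Finset.Icc 1 A.size := by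
  refine Finset.eq_of_subset_of_card_le (Finset.image_subset_iff.2 T.mem_range) ?_
  rw [Finset.card_image_of_injOn T.injOn, Nat.card_Icc]
  simp [SkewShape.size]

/-- The cells whose entry lies in the half-open interval `(a, b]`. -/
def block (a b : ℕ) : Finset (ℕ × ℕ) :=
  A.cells.filter (fun c => T.entry c ∈ Finset.Ioc a b)

lemma card_block (a : ℕ) {b : ℕ} (hb : b ≤ A.size) : (T.block a b).card = b - a := by
  rw [← Nat.card_Ioc, ← Finset.card_image_of_injOn (s := T.block a b)
    (T.injOn.mono (Finset.coe_subset.2 (Finset.filter_subset _ _)))]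
  congr 1
  ext k
  simp only [block, Finset.mem_image, Finset.mem_filter]
  constructor
  · rintro ⟨c, ⟨-, hc⟩, rfl⟩
    exact hc
  · intro hk
    have : k ∈ A.cells.image T.entry := by
      rw [T.image_entry, Finset.mem_Icc]
      rw [Finset.mem_Ioc] at hk
      omega
    obtain ⟨c, hc, rfl⟩ := Finset.mem_image.1 this
    exact ⟨c, ⟨hc, hk⟩, rfl⟩

lemma row_le_of_no_descent {a b : ℕ} (hab : ∀ d, a < d → d < b → d ∉ T.descentSet)
    {c : ℕ × ℕ} (hc : c ∈ A.cells) (hac : a < T.entry c) {y : ℕ} (hy : T.entry c ≤ y) :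
    y ≤ b → ∀ c' ∈ A.cells, T.entry c' = y → c'.1 ≤ c.1 := by
  induction y, hy using Nat.le_induction with
  | base =>
    intro _ c' hc' h
    rw [T.injOn hc' hc h]
  | succ y hy ih =>
    intro hyb c' hc' h
    have h1 := Finset.mem_Icc.1 (T.mem_range c hc)
    have h2 := Finset.mem_Icc.1 (T.mem_range c' hc')
    have hmem : y ∈ A.cells.image T.entry := by
      rw [T.image_entry, Finset.mem_Icc]
      omega
    obtain ⟨e, he, hey⟩ := Finset.mem_image.1 hmem
    refine le_trans ?_ (ih (by omega) e he hey)
    by_contra! hlt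
    refine hab y (by omega) (by omega) (Finset.mem_filter.2 ⟨?_, e, he, c', hc', hey, h, hlt⟩)
    rw [Finset.mem_Ico]
    omega

lemma card_block_column_le_one {a b : ℕ} (hab : ∀ d, a < d → d < b → d ∉ T.descentSet) (j : ℕ) :
    ((T.block a b).filter (fun c => c.2 = j)).card ≤ 1 := by
  have key : ∀ i i', (i, j) ∈ T.block a b → (i', j) ∈ T.block a b → ¬ i < i' := by
    intro i i' h h' hlt
    simp only [block, Finset.mem_filter, Finset.mem_Ioc] at h h'
    have := T.row_le_of_no_descent hab h.1 h.2.1 (T.col_lt i i' j h.1 h'.1 hlt).le h'.2.2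
      _ h'.1 rfl
    exact this.not_gt hlt
  rw [Finset.card_le_one]
  rintro ⟨i, k⟩ h ⟨i', k'⟩ h'
  obtain ⟨hb, rfl : k = j⟩ := Finset.mem_filter.1 h
  obtain ⟨hb', rfl : k' = k⟩ := Finset.mem_filter.1 h'
  rw [Prod.mk.injEq]
  exact ⟨le_antisymm (not_lt.1 (key i' i hb' hb)) (not_lt.1 (key i i' hb hb')), rfl⟩

lemma sum_card_block_le (I : Finset ℕ) (hI : I ⊆ Finset.range (T.descentSet.card + 1))
    (hn : A.size ≠ 0) :
    ∑ i ∈ I, (T.block (breaks A.size T.descentSet i) (breaks A.size T.descentSet (i + 1))).card ≤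
      ∑ c ∈ A.cells.image Prod.snd, min I.card (A.cells.filter (fun x => x.2 = c)).card := by
  set β : ℕ → Finset (ℕ × ℕ) := fun i =>
    T.block (breaks A.size T.descentSet i) (breaks A.size T.descentSet (i + 1)) with hβ
  have hr : ∀ i ∈ I, i ≤ T.descentSet.card := fun i hi => by
    have := Finset.mem_range.1 (hI hi)
    omega
  have hdisj : (I : Set ℕ).PairwiseDisjoint β := by
    have key : ∀ i ∈ I, ∀ k ∈ I, i < k → Disjoint (β i) (β k) := by
      intro i _ k hk hik
      rw [Finset.disjoint_left]
      intro c hc hc'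
      simp only [hβ, block, Finset.mem_filter, Finset.mem_Ioc] at hc hc'
      have hle : breaks A.size T.descentSet (i + 1) ≤ breaks A.size T.descentSet k := by
        rcases (Nat.succ_le_of_lt hik).lt_or_eq with h | rfl
        · exact (breaks_lt_breaks hn T.descentSet_subset h (by have := hr k hk; omega)).le
        · exact le_rfl
      omega
    intro i hi k hk hne
    rcases hne.lt_or_gt with h | h
    · exact key i hi k hk h
    · exact (key k hk i hi h).symm
  have hcol : ∀ i, (β i).card =
      ∑ c ∈ A.cells.image Prod.snd, ((β i).filter (fun x => x.2 = c)).card := fun i =>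
    Finset.card_eq_sum_card_fiberwise fun x hx =>
      Finset.mem_coe.2 (Finset.mem_image_of_mem _ (Finset.mem_filter.1 hx).1)
  rw [Finset.sum_congr rfl fun i _ => hcol i, Finset.sum_comm]
  refine Finset.sum_le_sum fun c _ => le_min ?_ ?_
  · refine (Finset.sum_le_card_nsmul I _ 1 fun i hi => ?_).trans (by simp)
    exact T.card_block_column_le_one
      (fun d => notMem_of_breaks_lt hn T.descentSet_subset (hr i hi)) c
  · rw [← Finset.card_biUnion fun i hi k hk hne =>
      (hdisj hi hk hne).mono (Finset.filter_subset _ _) (Finset.filter_subset _ _)]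
    refine Finset.card_le_card (Finset.biUnion_subset.2 fun i _ => ?_)
    exact Finset.filter_subset_filter _ (Finset.filter_subset _ _)

end SYT

theorem stmt5 (A : SkewShape) (α : List ℕ) (h : α ∈ Fsupp A) :
    Dom (↑α) (conjM (colsk A.cells 1)) := by
  obtain ⟨T, rfl⟩ := h
  intro j
  rcases eq_or_ne A.size 0 with hn | hn
  · simp [SYT.descentComp, compOfSet, hn, sortDesc]
  set u : Multiset ℕ := ↑((sortDesc ↑T.descentComp).take j) with hu
  have hle : u ≤ (Multiset.range (T.descentSet.card + 1)).map (fun i =>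
      breaks A.size T.descentSet (i + 1) - breaks A.size T.descentSet i) := by
    have h₁ : u ≤ ↑(sortDesc ↑T.descentComp) :=
      Multiset.coe_le.2 (List.take_sublist _ _).subperm
    rw [coe_sortDesc, SYT.descentComp, compOfSet_eq_map_breaks hn,
      ← Multiset.map_coe, Multiset.coe_range] at h₁
    exact h₁
  have hj : Multiset.card u ≤ j := by simp [hu]
  rw [← Multiset.sum_coe, ← hu]
  obtain ⟨I, hI, hIu⟩ := exists_finset_of_le_map hle
  have hIj : I.card ≤ j := by rwa [← hIu, Multiset.card_map] at hj
  calc u.sum = ∑ i ∈ I, (T.block (breaks A.size T.descentSet i)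
        (breaks A.size T.descentSet (i + 1))).card := by
        rw [← hIu]
        refine Finset.sum_congr rfl fun i hi => (T.card_block _ ?_).symm
        have := Finset.mem_range.1 (hI hi)
        exact breaks_le hn T.descentSet_subset (by omega)
    _ ≤ ∑ c ∈ A.cells.image Prod.snd, min I.card (A.cells.filter (fun x => x.2 = c)).card :=
        T.sum_card_block_le I hI hn
    _ ≤ ∑ c ∈ A.cells.image Prod.snd, min j (A.cells.filter (fun x => x.2 = c)).card :=
        Finset.sum_le_sum fun c _ => min_le_min_right _ hIj
    _ = ((colsk A.cells 1).map (fun x => min j x)).sum :=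
        (sum_map_colsk_one A.cells (f := fun x => min j x) (by simp)).symm
    _ ≤ _ := sum_min_le_sum_take_conjM _ _

end SkewPaper
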